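/- Let G be a finite Abelian group generated by a_1, ..., a_k, and let M be an integer matrix with k rows such that, for all integer vectors x = (x_1, ..., x_k)^T, one has a_1^{x_1} ⋯ a_k^{x_k} = e if and only if x ∈ intcol(M). Then there exist elements g_1, ..., g_l of G with l ≤ k such that G is the internal direct sum of the cyclic subgroups generated by the g_i: G = ⟨g_1⟩ ⊕ ⋯ ⊕ ⟨g_l⟩. -/

import Mathlib

/-- A linear map out of a finite free module over a PID admits a basis of its source such that
every relation between the images of the basis vectors is trivial in each coordinate. -/
theorem LinearMap.exists_basis_map_repr_smul_eq_zero {ι R M A : Type*} [Finite ι] [CommRing R]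
    [IsDomain R] [IsPrincipalIdealRing R] [AddCommGroup M] [Module R M] [AddCommGroup A]
    [Module R A] (b : Module.Basis ι R M) (φ : M →ₗ[R] A) :
    ∃ b' : Module.Basis ι R M, ∀ v i, φ v = 0 → φ (b'.repr v i • b' i) = 0 := by
  obtain ⟨n, snf⟩ := Submodule.smithNormalForm b (LinearMap.ker φ)
  refine ⟨snf.bM, fun v i hv => ?_⟩
  let w : LinearMap.ker φ := ⟨v, hv⟩
  by_cases hi : i ∈ Set.range snf.f
  · obtain ⟨j, rfl⟩ := hi
    have hcoord : snf.bM.repr v (snf.f j) = snf.bN.repr w j * snf.a j := by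
      have h := snf.repr_apply_embedding_eq_repr_smul w (i := j)
      rwa [map_smul, Finsupp.smul_apply, smul_eq_mul, mul_comm] at h
    rw [hcoord, mul_smul, ← snf.snf j, map_smul, LinearMap.mem_ker.mp (snf.bN j).2, smul_zero]
  · have hcoord : snf.bM.repr v i = 0 := snf.repr_eq_zero_of_notMem_range w hi
    rw [hcoord, zero_smul, map_zero]

/-- A commutative group generated by a family `a` indexed by a finite type is the internal direct
product of cyclic subgroups indexed by the same type. -/
theorem CommGroup.exists_bijective_prod_zpowers_of_closure_range_eq_top {ι G : Type*} [Fintype ι]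
    [CommGroup G] (a : ι → G) (hgen : Subgroup.closure (Set.range a) = ⊤) :
    ∃ g : ι → G, Function.Bijective
      (fun f : (∀ i, Subgroup.zpowers (g i)) => ∏ i, (f i : G)) := by
  classical
  let φ : (ι → ℤ) →ₗ[ℤ] Additive G :=
    Fintype.linearCombination ℤ (fun i => Additive.ofMul (a i))
  have hφ : ∀ h : G, ∃ v, φ v = Additive.ofMul h := by
    intro h
    have hh : h ∈ Subgroup.closure (Set.range a) := hgen ▸ Subgroup.mem_top h
    induction hh using Subgroup.closure_induction with
    | mem x hx =>
      obtain ⟨i, rfl⟩ := hx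
      exact ⟨Pi.single i 1, by simp [φ]⟩
    | one => exact ⟨0, by simp⟩
    | mul x y _ _ hx hy =>
      obtain ⟨v, hv⟩ := hx
      obtain ⟨w, hw⟩ := hy
      exact ⟨v + w, by rw [map_add, hv, hw, ofMul_mul]⟩
    | inv x _ hx =>
      obtain ⟨v, hv⟩ := hx
      exact ⟨-v, by rw [map_neg, hv, ofMul_inv]⟩
  obtain ⟨b, hb⟩ := LinearMap.exists_basis_map_repr_smul_eq_zero (Pi.basisFun ℤ ι) φ
  have hprod : ∀ x : ι → ℤ,
      φ (∑ i, x i • b i) = Additive.ofMul (∏ i, (φ (b i)).toMul ^ x i) := by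
    intro x
    simp only [map_sum, map_smul, ofMul_prod, ofMul_zpow, ofMul_toMul]
  refine ⟨fun i => (φ (b i)).toMul, fun f₁ f₂ h => ?_, fun h => ?_⟩
  · choose x hx using fun i => Subgroup.mem_zpowers_iff.mp (f₁ i).2
    choose y hy using fun i => Subgroup.mem_zpowers_iff.mp (f₂ i).2
    have hxy : φ (∑ i, (x i - y i) • b i) = 0 := by
      simp_rw [sub_smul]
      rw [Finset.sum_sub_distrib, map_sub, hprod, hprod]
      simp_rw [hx, hy]
      exact sub_eq_zero.mpr (congrArg Additive.ofMul h)
    funext i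
    have hi := hb _ i hxy
    rw [Module.Basis.repr_sum_self, sub_smul, map_sub, sub_eq_zero, map_smul, map_smul] at hi
    exact Subtype.ext ((hx i).symm.trans ((congrArg Additive.toMul hi).trans (hy i)))
  · obtain ⟨v, hv⟩ := hφ h
    refine ⟨fun i => ⟨_, Subgroup.zpow_mem_zpowers _ (b.repr v i)⟩, ?_⟩
    have hsum := hprod (b.repr v)
    rw [b.sum_repr, hv] at hsum
    exact (Additive.ofMul.injective hsum).symm

/-- Given a generating set `a₁, …, a_k` of a finite Abelian group `G` and an integer
matrix `M` with `k` rows such that `a₁^{x₁} ⋯ a_k^{x_k} = e` iff `x ∈ intcol(M)`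
(the set of integer linear combinations of the columns of `M`), there exist
`g₁, …, g_l ∈ G` with `l ≤ k` such that `G = ⟨g₁⟩ ⊕ ⋯ ⊕ ⟨g_l⟩`, i.e. the
multiplication map `⟨g₁⟩ × ⋯ × ⟨g_l⟩ → G` is a bijection. -/
theorem decompose_from_relation_matrix {G : Type*} [CommGroup G] [Finite G]
    (k n : ℕ) (a : Fin k → G) (hgen : Subgroup.closure (Set.range a) = ⊤)
    (M : Matrix (Fin k) (Fin n) ℤ)
    (hM : ∀ x : Fin k → ℤ,
      (∏ i, a i ^ x i = 1) ↔ ∃ c : Fin n → ℤ, x = M.mulVec c) :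
    ∃ (l : ℕ) (_ : l ≤ k) (g : Fin l → G),
      Function.Bijective
        (fun f : (∀ i, Subgroup.zpowers (g i)) => ∏ i, (f i : G)) := by
  exact ⟨k, le_rfl, CommGroup.exists_bijective_prod_zpowers_of_closure_range_eq_top a hgen⟩
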